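/- For any two gains L₁, L₂ ∈ S, the following matrix identity holds: X(L₁) − X(L₂) − A_{L₂}·(X(L₁) − X(L₂))·A_{L₂}ᵀ = (L₁·R − A_{L₁}·X(L₁)·Hᵀ)·(L₁ − L₂)ᵀ + (L₁ − L₂)·(R·L₁ᵀ − H·X(L₁)·A_{L₁}ᵀ) − (L₁ − L₂)·R·(L₁ − L₂)ᵀ − (L₁ − L₂)·H·X(L₁)·Hᵀ·(L₁ − L₂)ᵀ. -/

import Mathlib

open Matrix Filter Topology

/-- Spectral radius of a real square matrix: the maximum modulus of its complex
eigenvalues. -/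
noncomputable def specRad {n : ℕ} (M : Matrix (Fin n) (Fin n) ℝ) : ENNReal :=
  spectralRadius ℂ (M.map (Complex.ofReal))

section Frobenius

attribute [local instance] Matrix.frobeniusNormedAddCommGroup Matrix.frobeniusNormedSpace
  Matrix.frobeniusNormedRing Matrix.frobeniusNormedAlgebra

/-- Powers of a matrix of spectral radius less than one decay geometrically. -/
theorem exists_norm_pow_le_of_specRad_lt_one {n : ℕ} (M : Matrix (Fin n) (Fin n) ℝ)
    (hM : specRad M < 1) : ∃ r : ℝ, 0 ≤ r ∧ r < 1 ∧ ∀ᶠ t : ℕ in atTop, ‖M ^ t‖ ≤ r ^ t := by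
  obtain ⟨r, hr, hr1⟩ := ENNReal.lt_iff_exists_nnreal_btwn.1 hM
  have : CompleteSpace (Matrix (Fin n) (Fin n) ℂ) := FiniteDimensional.complete ℂ _
  have h := spectrum.pow_nnnorm_pow_one_div_tendsto_nhds_spectralRadius (M.map Complex.ofReal)
  refine ⟨r, r.2, by exact_mod_cast hr1, ?_⟩
  filter_upwards [h.eventually_lt_const hr, eventually_gt_atTop 0] with t ht ht0
  have hmap : M.map Complex.ofReal ^ t = (M ^ t).map Complex.ofReal :=
    (map_pow (Complex.ofRealHom.mapMatrix) M t).symm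
  have hnorm : ‖(M ^ t).map Complex.ofReal‖₊ = ‖M ^ t‖₊ :=
    Matrix.frobenius_nnnorm_map_eq _ _ fun a => Complex.nnnorm_real a
  have ht' : (0 : ℝ) < t := by exact_mod_cast ht0
  rw [hmap, hnorm, one_div, ENNReal.rpow_inv_lt_iff ht', ENNReal.rpow_natCast] at ht
  exact_mod_cast ht.le

theorem summable_pow_mul_mul_transpose_pow {n : ℕ} (M P : Matrix (Fin n) (Fin n) ℝ)
    (hM : specRad M < 1) : Summable fun t : ℕ => M ^ t * P * Mᵀ ^ t := by
  obtain ⟨r, hr0, hr1, hr⟩ := exists_norm_pow_le_of_specRad_lt_one M hM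
  have : CompleteSpace (Matrix (Fin n) (Fin n) ℝ) := FiniteDimensional.complete ℝ _
  have hg : Summable fun t : ℕ => ‖P‖ * (r * r) ^ t :=
    (summable_geometric_of_lt_one (by positivity) (by nlinarith)).mul_left _
  refine Summable.of_norm_bounded_eventually_nat hg ?_
  filter_upwards [hr] with t ht
  have hT : ‖Mᵀ ^ t‖ = ‖M ^ t‖ := by
    rw [← Matrix.transpose_pow, Matrix.frobenius_norm_transpose]
  calc ‖M ^ t * P * Mᵀ ^ t‖ ≤ ‖M ^ t‖ * ‖P‖ * ‖Mᵀ ^ t‖ := norm_mul₃_le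
    _ ≤ r ^ t * ‖P‖ * r ^ t := by rw [hT]; gcongr
    _ = ‖P‖ * (r * r) ^ t := by rw [mul_pow]; ring

end Frobenius

/-- The Lyapunov series solves the discrete Lyapunov equation. -/
theorem tsum_pow_mul_mul_transpose_pow {n : ℕ} (M P : Matrix (Fin n) (Fin n) ℝ)
    (hM : specRad M < 1) :
    ∑' t : ℕ, M ^ t * P * Mᵀ ^ t = M * (∑' t : ℕ, M ^ t * P * Mᵀ ^ t) * Mᵀ + P := by
  have hs := summable_pow_mul_mul_transpose_pow M P hM
  conv_lhs => rw [hs.tsum_eq_zero_add]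
  rw [← hs.tsum_mul_left, ← (hs.mul_left M).tsum_mul_right, add_comm]
  simp only [pow_zero, one_mul, mul_one]
  congr 1
  refine tsum_congr fun t => ?_
  rw [pow_succ', pow_succ]
  simp only [mul_assoc]

theorem stmt_9 {n m : ℕ} (hn : 0 < n) (hm : 0 < m)
    (A : Matrix (Fin n) (Fin n) ℝ) (H : Matrix (Fin m) (Fin n) ℝ)
    (Q : Matrix (Fin n) (Fin n) ℝ) (R : Matrix (Fin m) (Fin m) ℝ)
    (hQ : Q.PosDef) (hR : R.PosDef)
    (S : Set (Matrix (Fin n) (Fin m) ℝ))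
    (hS : S = {L | specRad (A - L * H) < 1})
    (X : Matrix (Fin n) (Fin m) ℝ → Matrix (Fin n) (Fin n) ℝ)
    (hX : ∀ L, X L = ∑' t : ℕ, (A - L * H) ^ t * (Q + L * R * Lᵀ) * ((A - L * H)ᵀ) ^ t)
    (L₁ L₂ : Matrix (Fin n) (Fin m) ℝ) (hL₁ : L₁ ∈ S) (hL₂ : L₂ ∈ S) :
    X L₁ - X L₂ - (A - L₂ * H) * (X L₁ - X L₂) * (A - L₂ * H)ᵀ =
      (L₁ * R - (A - L₁ * H) * X L₁ * Hᵀ) * (L₁ - L₂)ᵀ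
      + (L₁ - L₂) * (R * L₁ᵀ - H * X L₁ * (A - L₁ * H)ᵀ)
      - (L₁ - L₂) * R * (L₁ - L₂)ᵀ
      - (L₁ - L₂) * H * X L₁ * Hᵀ * (L₁ - L₂)ᵀ := by
  subst hS
  have h₁ := tsum_pow_mul_mul_transpose_pow (A - L₁ * H) (Q + L₁ * R * L₁ᵀ) hL₁
  have h₂ := tsum_pow_mul_mul_transpose_pow (A - L₂ * H) (Q + L₂ * R * L₂ᵀ) hL₂
  rw [← hX] at h₁ h₂
  have hsplit : X L₁ - X L₂ - (A - L₂ * H) * (X L₁ - X L₂) * (A - L₂ * H)ᵀ =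
      X L₁ - (A - L₂ * H) * X L₁ * (A - L₂ * H)ᵀ
        - (X L₂ - (A - L₂ * H) * X L₂ * (A - L₂ * H)ᵀ) := by
    rw [Matrix.mul_sub, Matrix.sub_mul]
    abel
  rw [hsplit, sub_eq_of_eq_add' h₂, sub_sub, sub_eq_iff_eq_add]
  refine h₁.trans ?_
  simp only [Matrix.transpose_sub, Matrix.transpose_mul, Matrix.mul_sub, Matrix.sub_mul,
    Matrix.mul_assoc]
  abel
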